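/- arXiv:2502.01031 — 6 statements merged into one kernel-verified Lean document; each statement's English description precedes it below -/
import Mathlib

section
/- Influence minimization is non-submodular: there exist a finite directed graph G = (V, E), activation probabilities p : E → [0,1], a seed set S ⊆ V, edge sets A ⊆ B ⊆ E, and an edge e ∈ E \ B such that f(A ∪ {e}) − f(A) < f(B ∪ {e}) − f(B), where f(𝓔) := σ(S; G, p) − σ(S; G_{\𝓔}, p_{\𝓔}). In particular, the influence-reduction function f : 2^E → ℝ is not a submodular set function in general. -/
open scoped Classical

noncomputable section

/-- `Reaches H S v`: vertex `v` is reachable from some vertex of `S`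
using only edges in `H`. -/
def Reaches {V : Type*} (H : Finset (V × V)) (S : Finset V) (v : V) : Prop :=
  ∃ s ∈ S, Relation.ReflTransGen (fun a b => (a, b) ∈ H) s v

/-- Influenced probability `π(v; (V,E), p, S)` under the live-edge formulation
of the independent cascade model. -/
def infProb {V : Type*} (E : Finset (V × V)) (p : V × V → ℝ) (S : Finset V) (v : V) : ℝ :=
  ∑ H ∈ E.powerset,
    (∏ e ∈ H, p e) * (∏ e ∈ E \ H, (1 - p e)) * (if Reaches H S v then 1 else 0)

/-- Expected influence `σ(S; (V,E), p)`. -/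
def expInf {V : Type*} [Fintype V] (E : Finset (V × V)) (p : V × V → ℝ) (S : Finset V) : ℝ :=
  ∑ v, infProb E p S v

/-- When all activation probabilities are `1`, every edge is live, so the influenced probability
is the indicator of reachability. -/
theorem infProb_one {V : Type*} (E : Finset (V × V)) (S : Finset V) (v : V) :
    infProb E (fun _ => 1) S v = if Reaches E S v then 1 else 0 := by
  unfold infProb
  rw [Finset.sum_eq_single_of_mem E (Finset.mem_powerset_self E)]
  · simp
  · intro H hH hne
    have h : ¬E ⊆ H := fun h => hne ((Finset.mem_powerset.1 hH).antisymm h)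
    simp [h]

/-- If every edge starts in the seed set, reachability takes at most one step. -/
theorem reaches_iff_of_fst_mem {V : Type*} {E : Finset (V × V)} {S : Finset V}
    (hE : ∀ e ∈ E, e.1 ∈ S) (v : V) :
    Reaches E S v ↔ v ∈ S ∨ ∃ s, (s, v) ∈ E := by
  constructor
  · rintro ⟨s, hs, h⟩
    rcases h.cases_tail with rfl | ⟨b, -, hb⟩
    · exact Or.inl hs
    · exact Or.inr ⟨b, hb⟩
  · rintro (hv | ⟨s, hs⟩)
    · exact ⟨v, hv, .refl⟩
    · exact ⟨s, hE _ hs, .single hs⟩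

/-- Expected influence on three vertices seeded at `0` and `1`, when all probabilities are `1`
and all edges start at a seed. -/
theorem expInf_one_fin_three {E : Finset (Fin 3 × Fin 3)}
    (hE : ∀ e ∈ E, e.1 ∈ ({0, 1} : Finset (Fin 3))) :
    expInf E (fun _ => 1) {0, 1} = 2 + if ∃ s, (s, 2) ∈ E then 1 else 0 := by
  simp only [expInf, infProb_one, reaches_iff_of_fst_mem hE, Fin.sum_univ_three]
  have h0 : (2 : Fin 3) ≠ 0 := by decide
  have h1 : (2 : Fin 3) ≠ 1 := by decide
  norm_num [h0, h1]

/-- Influence minimization is non-submodular: there exist a finite directed graph,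
activation probabilities in [0,1], a seed set, edge sets A ⊆ B ⊆ E and an edge
e ∈ E \ B violating the submodularity (diminishing returns) inequality for
f(𝓔) = σ(S; G, p) − σ(S; G_{\𝓔}, p_{\𝓔}). -/
theorem influence_minimization_non_submodular :
    ∃ (N : ℕ) (E : Finset (Fin N × Fin N)) (p : Fin N × Fin N → ℝ)
      (S : Finset (Fin N)) (A B : Finset (Fin N × Fin N)) (e : Fin N × Fin N),
      (∀ e' ∈ E, 0 ≤ p e' ∧ p e' ≤ 1) ∧
      A ⊆ B ∧ B ⊆ E ∧ e ∈ E \ B ∧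
      (expInf E p S - expInf (E \ (A ∪ {e})) p S) -
        (expInf E p S - expInf (E \ A) p S) <
      (expInf E p S - expInf (E \ (B ∪ {e})) p S) -
        (expInf E p S - expInf (E \ B) p S) := by
  have hE : ∀ X : Finset (Fin 3 × Fin 3),
      ∀ e ∈ ({(0, 2), (1, 2)} : Finset (Fin 3 × Fin 3)) \ X, e.1 ∈ ({0, 1} : Finset (Fin 3)) := by
    intro X e he
    have := (Finset.mem_sdiff.1 he).1
    simp only [Finset.mem_insert, Finset.mem_singleton] at this
    rcases this with rfl | rfl <;> simp
  refine ⟨3, {(0, 2), (1, 2)}, fun _ => 1, {0, 1}, ∅, {(0, 2)}, (1, 2), by simp, by simp, by simp,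
    by simp, ?_⟩
  rw [expInf_one_fin_three (hE (∅ ∪ {(1, 2)})), expInf_one_fin_three (hE ∅),
    expInf_one_fin_three (hE ({(0, 2)} ∪ {(1, 2)})), expInf_one_fin_three (hE {(0, 2)})]
  simp

end
end

section
/- Exchange lemma for the NP-hardness reduction: for every removal set 𝓔 ⊆ E_I and every second-layer edge (v_j, x_i) ∈ 𝓔, the modified removal set 𝓔' := (𝓔 \ {(v_j, x_i)}) ∪ {(v_init, v_j)} satisfies |𝓔'| ≤ |𝓔| and R(𝓔') ⊆ R(𝓔); in particular |R(𝓔')| ≤ |R(𝓔)|, so replacing the removal of any second-layer edge by the removal of the corresponding first-layer edge gives at least the same minimization performance. -/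
open scoped Classical

noncomputable section

/-- Vertices of the reduction graph: a root vertex, set-vertices v_1, …, v_m,
and element-vertices x_1, …, x_n. -/
abbrev Vtx (m n : ℕ) : Type := Unit ⊕ Fin m ⊕ Fin n

/-- The root vertex v_init. -/
def root (m n : ℕ) : Vtx m n := Sum.inl ()

/-- The set-vertex v_j. -/
def setV {m n : ℕ} (j : Fin m) : Vtx m n := Sum.inr (Sum.inl j)

/-- The element-vertex x_i. -/
def elemV {m n : ℕ} (i : Fin n) : Vtx m n := Sum.inr (Sum.inr i)

/-- First-layer edges (v_init, v_j), j ∈ [m]. -/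
def firstLayer (m n : ℕ) : Finset (Vtx m n × Vtx m n) :=
  Finset.univ.image fun j : Fin m => (root m n, setV j)

/-- Second-layer edges (v_j, x_i) for j ∈ [m] and i ∈ S_j. -/
def secondLayer (m n : ℕ) (Sets : Fin m → Finset (Fin n)) :
    Finset (Vtx m n × Vtx m n) :=
  Finset.univ.biUnion fun j : Fin m => (Sets j).image fun i => (setV j, elemV i)

/-- The edge set E_I of the reduction graph. -/
def edgesI (m n : ℕ) (Sets : Fin m → Finset (Fin n)) : Finset (Vtx m n × Vtx m n) :=
  firstLayer m n ∪ secondLayer m n Sets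

/-- R(𝓔): the set of vertices reachable from v_init using only edges in E_I \ 𝓔. -/
def reachSet (m n : ℕ) (Sets : Fin m → Finset (Fin n))
    (𝓔 : Finset (Vtx m n × Vtx m n)) : Finset (Vtx m n) :=
  Finset.univ.filter fun v =>
    Relation.ReflTransGen (fun a b => (a, b) ∈ edgesI m n Sets \ 𝓔) (root m n) v

lemma eq_root_of_mem_edgesI_setV {m n : ℕ} {Sets : Fin m → Finset (Fin n)}
    {b : Vtx m n} {j : Fin m} (h : (b, setV j) ∈ edgesI m n Sets) : b = root m n := by
  simp only [edgesI, firstLayer, secondLayer, Finset.mem_union, Finset.mem_image,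
    Finset.mem_biUnion, Finset.mem_univ, true_and, Prod.mk.injEq] at h
  rcases h with ⟨_, hb, _⟩ | ⟨_, _, _, _, hc⟩
  · exact hb.symm
  · simp [elemV, setV] at hc

/-- Once the edge from the root to `setV j` is removed, `setV j` is unreachable, so restoring
the edge `(setV j, elemV i)` creates no new reachable vertices. -/
lemma reachSet_exchange_subset {m n : ℕ} (Sets : Fin m → Finset (Fin n))
    (𝓔 : Finset (Vtx m n × Vtx m n)) (j : Fin m) (i : Fin n) :
    reachSet m n Sets ((𝓔 \ {(setV j, elemV i)}) ∪ {(root m n, setV j)}) ⊆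
      reachSet m n Sets 𝓔 := by
  intro v hv
  simp only [reachSet, Finset.mem_filter, Finset.mem_univ, true_and] at hv ⊢
  suffices h : Relation.ReflTransGen (fun a b => (a, b) ∈ edgesI m n Sets \ 𝓔) (root m n) v ∧
      v ≠ setV j from h.1
  induction hv with
  | refl => exact ⟨.refl, by simp [root, setV]⟩
  | @tail b c _ hbc ih =>
    obtain ⟨hb, hbj⟩ := ih
    simp only [Finset.mem_sdiff, Finset.mem_union, Finset.mem_singleton, not_or, not_and,
      not_not] at hbc
    obtain ⟨hE, hold, hnew⟩ := hbc
    refine ⟨hb.tail (Finset.mem_sdiff.2 ⟨hE, fun h => ?_⟩), ?_⟩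
    · exact hbj (Prod.mk.inj (hold h)).1
    · rintro rfl
      exact hnew (by rw [eq_root_of_mem_edgesI_setV hE])

/-- Exchange lemma: replacing the removal of a second-layer edge (v_j, x_i) by the
removal of the corresponding first-layer edge (v_init, v_j) does not increase the
removal budget and does not enlarge the reachable set. -/
theorem exchange_lemma {m n : ℕ} (Sets : Fin m → Finset (Fin n))
    (𝓔 : Finset (Vtx m n × Vtx m n)) (h𝓔 : 𝓔 ⊆ edgesI m n Sets)
    (j : Fin m) (i : Fin n) (he : (setV j, elemV i) ∈ 𝓔) :
    ((𝓔 \ {(setV j, elemV i)}) ∪ {(root m n, setV j)}).card ≤ 𝓔.card ∧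
    reachSet m n Sets ((𝓔 \ {(setV j, elemV i)}) ∪ {(root m n, setV j)}) ⊆
      reachSet m n Sets 𝓔 ∧
    (reachSet m n Sets ((𝓔 \ {(setV j, elemV i)}) ∪ {(root m n, setV j)})).card ≤
      (reachSet m n Sets 𝓔).card := by
  have hsub := reachSet_exchange_subset Sets 𝓔 j i
  refine ⟨?_, hsub, Finset.card_le_card hsub⟩
  calc _ ≤ (𝓔 \ {(setV j, elemV i)}).card + 1 := Finset.card_union_le _ _
    _ = 𝓔.card := by
      rw [Finset.sdiff_singleton_eq_erase, Finset.card_erase_add_one he]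

end
end

section
/- Reachable-set formula for first-layer removals: for every T ⊆ {1, …, m}, setting 𝓔_T := {(v_init, v_j) : j ∉ T}, the reachable set is exactly R(𝓔_T) = {v_init} ∪ {v_j : j ∈ T} ∪ {x_i : i ∈ ⋃_{j ∈ T} S_j}, and hence |R(𝓔_T)| = 1 + |T| + |⋃_{j ∈ T} S_j|. -/
open scoped Classical

noncomputable section

theorem setV_injective {m n : ℕ} : Function.Injective (setV : Fin m → Vtx m n) :=
  Sum.inr_injective.comp Sum.inl_injective

theorem elemV_injective {m n : ℕ} : Function.Injective (elemV : Fin n → Vtx m n) :=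
  Sum.inr_injective.comp Sum.inr_injective

/-- The edges that survive the removal of the first-layer edges outside `T`. -/
theorem mem_edgesI_sdiff_iff {m n : ℕ} (Sets : Fin m → Finset (Fin n)) (T : Finset (Fin m))
    (a b : Vtx m n) :
    (a, b) ∈ edgesI m n Sets \ ((Finset.univ \ T).image fun j => (root m n, setV j)) ↔
      (∃ j ∈ T, a = root m n ∧ b = setV j) ∨
        ∃ j, ∃ i ∈ Sets j, a = setV j ∧ b = elemV i := by
  rcases a with a | a | a <;> rcases b with b | b | b <;>
    simp [edgesI, firstLayer, secondLayer, root, setV, elemV]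

/-- The reachable set after removing the first-layer edges outside `T`. -/
theorem reachSet_image_compl {m n : ℕ} (Sets : Fin m → Finset (Fin n)) (T : Finset (Fin m)) :
    reachSet m n Sets ((Finset.univ \ T).image fun j => (root m n, setV j)) =
      ({root m n} : Finset (Vtx m n)) ∪ T.image setV ∪ (T.biUnion Sets).image elemV := by
  ext v
  simp only [reachSet, mem_edgesI_sdiff_iff, Finset.mem_filter, Finset.mem_univ, true_and]
  constructor
  · intro h
    induction h with
    | refl => simp
    | tail _ hbc ih =>
      rcases hbc with ⟨j, hj, rfl, rfl⟩ | ⟨j, i, hi, rfl, rfl⟩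
      · simp [root, setV, hj]
      · have hj : j ∈ T := by simpa [root, setV, elemV] using ih
        have hmem : i ∈ T.biUnion Sets := Finset.mem_biUnion.2 ⟨j, hj, hi⟩
        exact Finset.mem_union_right _ (Finset.mem_image_of_mem _ hmem)
  · simp only [Finset.mem_union, Finset.mem_singleton, Finset.mem_image, Finset.mem_biUnion]
    rintro ((rfl | ⟨j, hj, rfl⟩) | ⟨i, ⟨j, hj, hi⟩, rfl⟩)
    · exact .refl
    · exact .single (.inl ⟨j, hj, rfl, rfl⟩)
    · exact .tail (.single (.inl ⟨j, hj, rfl, rfl⟩)) (.inr ⟨j, i, hi, rfl, rfl⟩)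

/-- Reachable-set formula for first-layer removals: removing exactly the first-layer
edges (v_init, v_j) with j ∉ T leaves reachable exactly the root, the set-vertices
v_j with j ∈ T, and the element-vertices x_i with i ∈ ⋃_{j ∈ T} S_j; hence
|R(𝓔_T)| = 1 + |T| + |⋃_{j ∈ T} S_j|. -/
theorem first_layer_reach_formula {m n : ℕ} (Sets : Fin m → Finset (Fin n))
    (T : Finset (Fin m)) :
    reachSet m n Sets ((Finset.univ \ T).image fun j => (root m n, setV j)) =
      ({root m n} : Finset (Vtx m n)) ∪ T.image setV ∪ (T.biUnion Sets).image elemV ∧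
    (reachSet m n Sets ((Finset.univ \ T).image fun j => (root m n, setV j))).card =
      1 + T.card + (T.biUnion Sets).card := by
  refine ⟨reachSet_image_compl Sets T, ?_⟩
  rw [reachSet_image_compl, Finset.card_union_of_disjoint, Finset.card_union_of_disjoint,
    Finset.card_singleton, Finset.card_image_of_injective _ setV_injective,
    Finset.card_image_of_injective _ elemV_injective]
  · simp [root, setV]
  · simp [Finset.disjoint_left, root, setV, elemV]

end
end

section
/- In the reduction construction, an optimal removal consisting only of first-layer edges always exists: for every budget b with b ≤ m there exists 𝓔* ⊆ {(v_init, v_j) : j ∈ [m]} with |𝓔*| = b such that |R(𝓔*)| ≤ |R(𝓔)| for every 𝓔 ⊆ E_I with |𝓔| = b. -/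
open scoped Classical

noncomputable section

/-- The first-layer edge lying above an edge: a first-layer edge is kept, and (v_j, x_i) is
sent to (v_init, v_j). -/
def liftEdge {m n : ℕ} (e : Vtx m n × Vtx m n) : Vtx m n × Vtx m n :=
  if e.1 = root m n then e else (root m n, e.1)

theorem liftEdge_root {m n : ℕ} (v : Vtx m n) : liftEdge (root m n, v) = (root m n, v) := by
  simp [liftEdge]

theorem liftEdge_setV {m n : ℕ} (j : Fin m) (v : Vtx m n) :
    liftEdge (setV j, v) = (root m n, setV j) := by
  simp [liftEdge, setV, root]

theorem mem_edgesI {m n : ℕ} {Sets : Fin m → Finset (Fin n)} {e : Vtx m n × Vtx m n} :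
    e ∈ edgesI m n Sets ↔
      (∃ j, e = (root m n, setV j)) ∨ ∃ j, ∃ i ∈ Sets j, e = (setV j, elemV i) := by
  simp [edgesI, firstLayer, secondLayer, eq_comm]

theorem mem_firstLayer {m n : ℕ} (j : Fin m) : (root m n, setV j) ∈ firstLayer m n := by
  simp [firstLayer]

theorem card_firstLayer (m n : ℕ) : (firstLayer m n).card = m := by
  rw [firstLayer, Finset.card_image_of_injective, Finset.card_univ, Fintype.card_fin]
  intro i j h
  simpa [setV] using h

theorem image_liftEdge_subset_firstLayer {m n : ℕ} {Sets : Fin m → Finset (Fin n)}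
    {𝓔 : Finset (Vtx m n × Vtx m n)} (h𝓔 : 𝓔 ⊆ edgesI m n Sets) :
    𝓔.image liftEdge ⊆ firstLayer m n := by
  refine Finset.image_subset_iff.2 fun e he => ?_
  rcases mem_edgesI.1 (h𝓔 he) with ⟨j, rfl⟩ | ⟨j, i, -, rfl⟩
  · rw [liftEdge_root]
    exact mem_firstLayer j
  · rw [liftEdge_setV]
    exact mem_firstLayer j

/-- Removing the first-layer edges above all edges of `𝓔` leaves nothing reachable that is not
reachable after removing `𝓔`. -/
theorem reachSet_subset_of_image_liftEdge_subset {m n : ℕ} {Sets : Fin m → Finset (Fin n)}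
    {𝓔 𝓕 : Finset (Vtx m n × Vtx m n)} (h : 𝓔.image liftEdge ⊆ 𝓕) :
    reachSet m n Sets 𝓕 ⊆ reachSet m n Sets 𝓔 := by
  intro v hv
  simp only [reachSet, Finset.mem_filter, Finset.mem_univ, true_and] at hv ⊢
  suffices H : Relation.ReflTransGen (fun a b => (a, b) ∈ edgesI m n Sets \ 𝓔) (root m n) v ∧
      ∀ j, v = setV j → (root m n, setV j) ∉ 𝓕 from H.1
  induction hv with
  | refl => exact ⟨.refl, fun j hj => by simp [root, setV] at hj⟩
  | @tail a c _ hac ih =>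
    obtain ⟨hE, hF⟩ := Finset.mem_sdiff.1 hac
    have hnot : liftEdge (a, c) ∉ 𝓕 → (a, c) ∉ 𝓔 := fun h1 h2 =>
      h1 (h (Finset.mem_image_of_mem _ h2))
    rcases mem_edgesI.1 hE with ⟨j, hj⟩ | ⟨j, i, -, hj⟩
    · obtain ⟨rfl, rfl⟩ := Prod.mk.inj hj
      refine ⟨ih.1.tail (Finset.mem_sdiff.2 ⟨hE, hnot ?_⟩), fun k hk => hk ▸ hF⟩
      rwa [liftEdge_root]
    · obtain ⟨rfl, rfl⟩ := Prod.mk.inj hj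
      refine ⟨ih.1.tail (Finset.mem_sdiff.2 ⟨hE, hnot ?_⟩),
        fun k hk => by simp [elemV, setV] at hk⟩
      rw [liftEdge_setV]
      exact ih.2 j rfl

/-- In the reduction construction, an optimal removal consisting only of first-layer
edges always exists: for every budget b ≤ m there is 𝓔* ⊆ {(v_init, v_j) : j ∈ [m]}
with |𝓔*| = b minimizing |R(·)| among all removal sets 𝓔 ⊆ E_I with |𝓔| = b. -/
theorem exists_first_layer_optimal_removal {m n : ℕ} (Sets : Fin m → Finset (Fin n))
    (b : ℕ) (hb : b ≤ m) :
    ∃ 𝓔star ⊆ firstLayer m n, 𝓔star.card = b ∧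
      ∀ 𝓔 ⊆ edgesI m n Sets, 𝓔.card = b →
        (reachSet m n Sets 𝓔star).card ≤ (reachSet m n Sets 𝓔).card := by
  have hne : ((firstLayer m n).powersetCard b).Nonempty := by
    rw [Finset.powersetCard_nonempty, card_firstLayer]
    exact hb
  obtain ⟨𝓔star, hstar, hmin⟩ :=
    Finset.exists_min_image _ (fun 𝓕 => (reachSet m n Sets 𝓕).card) hne
  obtain ⟨hsub, hcard⟩ := Finset.mem_powersetCard.1 hstar
  refine ⟨𝓔star, hsub, hcard, fun 𝓔 h𝓔 hb𝓔 => ?_⟩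
  obtain ⟨𝓕, hlift, h𝓕, hb𝓕⟩ := Finset.exists_subsuperset_card_eq
    (image_liftEdge_subset_firstLayer h𝓔) (Finset.card_image_le.trans hb𝓔.le)
    (hb.trans_eq (card_firstLayer m n).symm)
  exact (hmin 𝓕 (Finset.mem_powersetCard.2 ⟨h𝓕, hb𝓕⟩)).trans
    (Finset.card_le_card (reachSet_subset_of_image_liftEdge_subset hlift))

end
end

section
/- Correctness of the reduction from minimum k-union (core of the NP-hardness proof): for every k with 1 ≤ k ≤ m, the minimum number of vertices reachable from v_init after removing exactly m − k edges equals one plus k plus the optimal k-union value; formally, min_{𝓔 ⊆ E_I, |𝓔| = m − k} |R(𝓔)| = 1 + k + min_{T ⊆ [m], |T| = k} |⋃_{j ∈ T} S_j|. -/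
open scoped Classical

noncomputable section

/-- The root, the set-vertices indexed by `T`, and the element-vertices covered by `T`. -/
def closureOf {m n : ℕ} (Sets : Fin m → Finset (Fin n)) (T : Finset (Fin m)) :
    Finset (Vtx m n) :=
  Finset.univ.disjSum (T.disjSum (T.biUnion Sets))

theorem card_closureOf {m n : ℕ} (Sets : Fin m → Finset (Fin n)) (T : Finset (Fin m)) :
    (closureOf Sets T).card = 1 + T.card + (T.biUnion Sets).card := by
  simp [closureOf, Finset.card_disjSum, add_assoc]

/-- Removing exactly the first-layer edges to indices outside `T` confines the reachable
vertices to `closureOf Sets T`. -/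
theorem reachSet_subset_closureOf {m n : ℕ} (Sets : Fin m → Finset (Fin n))
    (T : Finset (Fin m)) :
    reachSet m n Sets (Tᶜ.image fun j => (root m n, setV j)) ⊆ closureOf Sets T := by
  intro v hv
  simp only [reachSet, Finset.mem_filter, Finset.mem_univ, true_and] at hv
  induction hv with
  | refl => simp [closureOf, root]
  | tail _ hbc ih =>
    obtain ⟨he, hne⟩ := Finset.mem_sdiff.1 hbc
    rcases mem_edgesI.1 he with ⟨j, h⟩ | ⟨j, i, hi, h⟩
    · rw [h] at hne
      obtain ⟨rfl, rfl⟩ := Prod.mk.inj h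
      have hj : j ∈ T := by
        by_contra hj
        exact hne (Finset.mem_image.2 ⟨j, Finset.mem_compl.2 hj, rfl⟩)
      simpa [closureOf, setV] using hj
    · obtain ⟨rfl, rfl⟩ := Prod.mk.inj h
      have hj : j ∈ T := by simpa [closureOf, setV] using ih
      simpa [closureOf, elemV] using ⟨j, hj, hi⟩

/-- If no edge into or out of a set-vertex indexed by `T` is removed, then all of
`closureOf Sets T` stays reachable. -/
theorem closureOf_subset_reachSet {m n : ℕ} (Sets : Fin m → Finset (Fin n))
    (T : Finset (Fin m)) (𝓔 : Finset (Vtx m n × Vtx m n))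
    (h : ∀ j ∈ T, ∀ e ∈ 𝓔, e.1 ≠ setV j ∧ e.2 ≠ setV j) :
    closureOf Sets T ⊆ reachSet m n Sets 𝓔 := by
  have first : ∀ j ∈ T, (root m n, setV j) ∈ edgesI m n Sets \ 𝓔 := fun j hj =>
    Finset.mem_sdiff.2 ⟨mem_edgesI.2 (Or.inl ⟨j, rfl⟩), fun he => (h j hj _ he).2 rfl⟩
  intro v hv
  simp only [reachSet, Finset.mem_filter, Finset.mem_univ, true_and]
  rcases v with u | j | i
  · exact .refl
  · have hj : j ∈ T := by simpa [closureOf] using hv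
    exact .single (first j hj)
  · obtain ⟨j, hj, hi⟩ : ∃ j ∈ T, i ∈ Sets j := by simpa [closureOf] using hv
    exact (Relation.ReflTransGen.single (first j hj)).tail <|
      Finset.mem_sdiff.2 ⟨mem_edgesI.2 (Or.inr ⟨j, i, hi, rfl⟩), fun he => (h j hj _ he).1 rfl⟩

/-- Every edge touches exactly one set-vertex, so removing edges touches at most as many
set-vertices as there are removed edges. -/
theorem card_touched_le {m n : ℕ} (Sets : Fin m → Finset (Fin n))
    (𝓔 : Finset (Vtx m n × Vtx m n)) (h𝓔 : 𝓔 ⊆ edgesI m n Sets) :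
    (Finset.univ.filter fun j : Fin m => ∃ e ∈ 𝓔, e.1 = setV j ∨ e.2 = setV j).card
      ≤ 𝓔.card := by
  refine Finset.card_le_card_of_forall_subsingleton
    (fun j e => e.1 = setV j ∨ e.2 = setV j) (fun j hj => (Finset.mem_filter.1 hj).2) ?_
  rintro e he j ⟨-, hj⟩ j' ⟨-, hj'⟩
  rcases mem_edgesI.1 (h𝓔 he) with ⟨l, rfl⟩ | ⟨l, i, -, rfl⟩ <;>
    simp_all [root, setV, elemV]

/-- Correctness of the reduction from minimum k-union: for 1 ≤ k ≤ m, the minimum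
number of vertices reachable from v_init after removing exactly m − k edges equals
1 + k + the optimal k-union value. -/
theorem reduction_correctness {m n : ℕ} (Sets : Fin m → Finset (Fin n))
    (k : ℕ) (hk1 : 1 ≤ k) (hkm : k ≤ m) :
    sInf {c : ℕ | ∃ 𝓔 ⊆ edgesI m n Sets, 𝓔.card = m - k ∧
        (reachSet m n Sets 𝓔).card = c} =
      1 + k + sInf {c : ℕ | ∃ T : Finset (Fin m), T.card = k ∧
        (T.biUnion Sets).card = c} := by
  apply le_antisymm
  · obtain ⟨T₀, -, hT₀⟩ := Finset.exists_subset_card_eq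
      (show k ≤ (Finset.univ : Finset (Fin m)).card by simpa using hkm)
    obtain ⟨T, hT, hc⟩ := Nat.sInf_mem (s := {c : ℕ | ∃ T : Finset (Fin m), T.card = k ∧
      (T.biUnion Sets).card = c}) ⟨_, T₀, hT₀, rfl⟩
    rw [← hc, ← hT, ← card_closureOf]
    refine le_trans (Nat.sInf_le ⟨_, ?_, ?_, rfl⟩)
      (Finset.card_le_card (reachSet_subset_closureOf Sets T))
    · intro e he
      obtain ⟨j, -, rfl⟩ := Finset.mem_image.1 he
      exact mem_edgesI.2 (Or.inl ⟨j, rfl⟩)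
    · rw [Finset.card_image_of_injective _ fun a b hab => by simpa [setV] using hab,
        Finset.card_compl, Fintype.card_fin]
  · refine le_csInf ?_ ?_
    · have hle : m - k ≤ (edgesI m n Sets).card :=
        calc m - k ≤ m := Nat.sub_le m k
          _ = (firstLayer m n).card := by
            rw [firstLayer, Finset.card_image_of_injective _
              fun a b hab => by simpa [setV] using hab, Finset.card_fin]
          _ ≤ _ := Finset.card_le_card Finset.subset_union_left
      obtain ⟨𝓔, h𝓔, hc⟩ := Finset.exists_subset_card_eq hle
      exact ⟨_, 𝓔, h𝓔, hc, rfl⟩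
    · rintro _ ⟨𝓔, h𝓔, hcard, rfl⟩
      have hle := card_touched_le Sets 𝓔 h𝓔
      set D := Finset.univ.filter fun j : Fin m => ∃ e ∈ 𝓔, e.1 = setV j ∨ e.2 = setV j
      obtain ⟨T, hTD, hT⟩ := Finset.exists_subset_card_eq (show k ≤ Dᶜ.card by
        rw [Finset.card_compl, Fintype.card_fin]; omega)
      have hopt : sInf {c : ℕ | ∃ T : Finset (Fin m), T.card = k ∧ (T.biUnion Sets).card = c}
          ≤ (T.biUnion Sets).card := Nat.sInf_le ⟨T, hT, rfl⟩
      calc _ ≤ 1 + k + (T.biUnion Sets).card := Nat.add_le_add_left hopt _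
        _ = (closureOf Sets T).card := by rw [card_closureOf, hT]
        _ ≤ _ := Finset.card_le_card <| closureOf_subset_reachSet Sets T 𝓔 fun j hj e he => by
          have hjD := Finset.mem_compl.1 (hTD hj)
          refine ⟨fun h => hjD ?_, fun h => hjD ?_⟩
          · exact Finset.mem_filter.2 ⟨Finset.mem_univ j, e, he, Or.inl h⟩
          · exact Finset.mem_filter.2 ⟨Finset.mem_univ j, e, he, Or.inr h⟩

end
end

section
/- Optimal k-union solutions are recovered from optimal influence-minimizing removals: let 1 ≤ k ≤ m and let 𝓔 ⊆ {(v_init, v_j) : j ∈ [m]} with |𝓔| = m − k be such that |R(𝓔)| ≤ |R(𝓔')| for every 𝓔' ⊆ E_I with |𝓔'| = m − k. Then T := {j ∈ [m] : (v_init, v_j) ∉ 𝓔} satisfies |T| = k and |⋃_{j ∈ T} S_j| = min_{T' ⊆ [m], |T'| = k} |⋃_{j ∈ T'} S_j|, i.e., T is an optimal solution of the minimum k-union instance. -/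
open scoped Classical

noncomputable section

/-- The indices of the set-vertices whose first-layer edge survives the removal of `𝓔`. -/
def keptSets {m n : ℕ} (𝓔 : Finset (Vtx m n × Vtx m n)) : Finset (Fin m) :=
  Finset.univ.filter fun j : Fin m => (root m n, setV j) ∉ 𝓔

/-- The first-layer edges leading to set-vertices with index outside `T`. -/
def removalOf {m : ℕ} (n : ℕ) (T : Finset (Fin m)) : Finset (Vtx m n × Vtx m n) :=
  Tᶜ.image fun j => (root m n, setV j)

theorem removalOf_subset_firstLayer {m n : ℕ} (T : Finset (Fin m)) :
    removalOf n T ⊆ firstLayer m n :=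
  Finset.image_subset_image (Finset.subset_univ _)

theorem card_removalOf {m n : ℕ} (T : Finset (Fin m)) :
    (removalOf n T).card = m - T.card := by
  rw [removalOf, Finset.card_image_of_injective _ fun a b h => setV_injective (Prod.ext_iff.1 h).2,
    Finset.card_compl, Fintype.card_fin]

theorem removalOf_keptSets {m n : ℕ} {𝓔 : Finset (Vtx m n × Vtx m n)}
    (hfl : 𝓔 ⊆ firstLayer m n) : removalOf n (keptSets 𝓔) = 𝓔 := by
  ext e
  simp only [removalOf, keptSets, Finset.mem_image, Finset.mem_compl, Finset.mem_filter,
    Finset.mem_univ, true_and, not_not]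
  constructor
  · rintro ⟨j, hj, rfl⟩
    exact hj
  · intro he
    obtain ⟨j, -, rfl⟩ := Finset.mem_image.1 (hfl he)
    exact ⟨j, he, rfl⟩

/-- Removing the first-layer edges outside `T` leaves reachable exactly the root, the set-vertices
indexed by `T`, and the elements of the sets indexed by `T`. -/
theorem reachSet_removalOf {m n : ℕ} (Sets : Fin m → Finset (Fin n)) (T : Finset (Fin m)) :
    reachSet m n Sets (removalOf n T) =
      (Finset.univ : Finset Unit).disjSum (T.disjSum (T.biUnion Sets)) := by
  ext v
  simp only [reachSet, Finset.mem_filter, Finset.mem_univ, true_and]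
  constructor
  · intro h
    induction h with
    | refl => simp [root]
    | tail _ hab ih =>
      simp only [edgesI, firstLayer, secondLayer, removalOf, Finset.mem_sdiff, Finset.mem_union,
        Finset.mem_image, Finset.mem_biUnion, Finset.mem_univ, true_and, Finset.mem_compl,
        Prod.mk.injEq] at hab
      obtain ⟨⟨j, rfl, rfl⟩ | ⟨j, i, hi, rfl, rfl⟩, hrem⟩ := hab
      · have hj : j ∈ T := by
          by_contra hj
          exact hrem ⟨j, hj, rfl, rfl⟩
        simpa [setV] using hj
      · have hj : j ∈ T := by simpa [setV] using ih
        simpa [elemV] using ⟨j, hj, hi⟩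
  · have reach_set {j : Fin m} (hj : j ∈ T) : Relation.ReflTransGen
        (fun a b => (a, b) ∈ edgesI m n Sets \ removalOf n T) (root m n) (setV j) := by
      refine .single ?_
      simp [edgesI, firstLayer, removalOf, setV_injective.eq_iff, hj]
    rcases v with _ | j | i
    · exact fun _ => .refl
    · intro h
      exact reach_set (by simpa using h)
    · intro h
      obtain ⟨j, hj, hi⟩ : ∃ j ∈ T, i ∈ Sets j := by simpa using h
      refine (reach_set hj).tail (Finset.mem_sdiff.2 ⟨Finset.mem_union_right _ ?_, ?_⟩)
      · exact Finset.mem_biUnion.2 ⟨j, Finset.mem_univ _, Finset.mem_image.2 ⟨i, hi, rfl⟩⟩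
      · simp [removalOf, root, setV]

theorem card_reachSet_removalOf {m n : ℕ} (Sets : Fin m → Finset (Fin n)) (T : Finset (Fin m)) :
    (reachSet m n Sets (removalOf n T)).card = 1 + (T.card + (T.biUnion Sets).card) := by
  simp [reachSet_removalOf, Finset.card_disjSum]

/-- Optimal k-union solutions are recovered from optimal influence-minimizing
removals: if 𝓔 consists of m − k first-layer edges and minimizes |R(·)| among all
removal sets of size m − k, then T = {j : (v_init, v_j) ∉ 𝓔} has size k and attains
the minimum k-union value. -/
theorem optimal_k_union_recovery {m n : ℕ} (Sets : Fin m → Finset (Fin n))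
    (k : ℕ) (hk1 : 1 ≤ k) (hkm : k ≤ m)
    (𝓔 : Finset (Vtx m n × Vtx m n)) (hfl : 𝓔 ⊆ firstLayer m n)
    (hcard : 𝓔.card = m - k)
    (hopt : ∀ 𝓔' ⊆ edgesI m n Sets, 𝓔'.card = m - k →
      (reachSet m n Sets 𝓔).card ≤ (reachSet m n Sets 𝓔').card) :
    (Finset.univ.filter fun j : Fin m => (root m n, setV j) ∉ 𝓔).card = k ∧
    ((Finset.univ.filter fun j : Fin m => (root m n, setV j) ∉ 𝓔).biUnion Sets).card =
      sInf {c : ℕ | ∃ T' : Finset (Fin m), T'.card = k ∧ (T'.biUnion Sets).card = c} := by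
  change (keptSets 𝓔).card = k ∧ ((keptSets 𝓔).biUnion Sets).card = _
  have hremoval := removalOf_keptSets hfl
  have hT : (keptSets 𝓔).card = k := by
    have hc := card_removalOf (n := n) (keptSets 𝓔)
    rw [hremoval, hcard] at hc
    have hle := card_finset_fin_le (keptSets 𝓔)
    omega
  have hleast : IsLeast {c : ℕ | ∃ T' : Finset (Fin m), T'.card = k ∧ (T'.biUnion Sets).card = c}
      ((keptSets 𝓔).biUnion Sets).card := by
    refine ⟨⟨_, hT, rfl⟩, ?_⟩
    rintro _ ⟨T', hT', rfl⟩
    have h := hopt (removalOf n T')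
      ((removalOf_subset_firstLayer T').trans Finset.subset_union_left)
      (by rw [card_removalOf, hT'])
    rw [← hremoval, card_reachSet_removalOf, card_reachSet_removalOf, hT, hT'] at h
    omega
  exact ⟨hT, hleast.csInf_eq.symm⟩

end
end
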